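/- Let G be an undirected multigraph with distinct vertices s and t, and let G' be obtained from G by replacing every edge {u,v} by a path of length three between u and v (with two new internal vertices per edge). Then, for every p ≥ 1, G admits p s-t trails sharing no edge if and only if G' admits p s-t trails sharing no edge. -/

import Mathlib

namespace PaperRCA

/-- A walk in an undirected multigraph whose edge type is `E`, with endpoint maps
`tl, hd : E → V`: a vertex list `vs = v₀, …, v_ℓ` together with an edge list
`es = e₁, …, e_ℓ`, where the edge `e_r` joins `v_{r-1}` and `v_r`. -/
def IsUMWalk {V E : Type*} (tl hd : E → V) (vs : List V) (es : List E) : Prop :=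
  vs.length = es.length + 1 ∧
  ∀ (r : ℕ) (e : E) (a b : V), es[r]? = some e → vs[r]? = some a →
    vs[r + 1]? = some b → s(tl e, hd e) = s(a, b)

/-- An individual edge copy `e` is shared by a family of multigraph trails, given by
their edge lists, if it occurs at the same position in two distinct trails. -/
def SharedMultiEdge {E : Type*} {p : ℕ} (W : Fin p → List E) (e : E) : Prop :=
  ∃ i j : Fin p, i ≠ j ∧ ∃ r : ℕ, (W i)[r]? = some e ∧ (W j)[r]? = some e

/-- The multigraph `G'` obtained from `G` by replacing every edge by a path of
length three: each edge `e` gives two new internal vertices `(e,0), (e,1)` and three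
sub-edges `(e,0), (e,1), (e,2)`. First endpoint of a sub-edge. -/
def subTl {V E : Type*} (tl : E → V) : E × Fin 3 → V ⊕ E × Fin 2 :=
  fun q => if q.2 = 0 then Sum.inl (tl q.1)
    else Sum.inr (q.1, if q.2 = 1 then 0 else 1)

/-- Second endpoint of a sub-edge of the length-three subdivision. -/
def subHd {V E : Type*} (hd : E → V) : E × Fin 3 → V ⊕ E × Fin 2 :=
  fun q => if q.2 = 2 then Sum.inl (hd q.1)
    else Sum.inr (q.1, if q.2 = 0 then 0 else 1)

/-- `es` is the edge list of a walk from `a` to `b`. -/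
def Joins {V E : Type*} (tl hd : E → V) : V → List E → V → Prop
  | a, [], b => a = b
  | a, e :: es, b => ∃ c, s(tl e, hd e) = s(a, c) ∧ Joins tl hd c es b

theorem isUMWalk_cons_cons {V E : Type*} {tl hd : E → V} {a b : V} {vs : List V} {e : E}
    {es : List E} : IsUMWalk tl hd (a :: b :: vs) (e :: es) ↔
      s(tl e, hd e) = s(a, b) ∧ IsUMWalk tl hd (b :: vs) es := by
  constructor
  · rintro ⟨hl, h⟩
    refine ⟨h 0 e a b rfl rfl rfl, by simpa using hl, fun r f x y hf hx hy => ?_⟩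
    exact h (r + 1) f x y (by simpa using hf) (by simpa using hx) (by simpa using hy)
  · rintro ⟨h0, hl, h⟩
    refine ⟨by simpa using hl, fun r f x y hf hx hy => ?_⟩
    cases r with
    | zero => simp_all
    | succ r => exact h r f x y (by simpa using hf) (by simpa using hx) (by simpa using hy)

theorem joins_iff_exists_isUMWalk {V E : Type*} {tl hd : E → V} {a b : V} {es : List E} :
    Joins tl hd a es b ↔
      ∃ vs, IsUMWalk tl hd vs es ∧ vs.head? = some a ∧ vs.getLast? = some b := by
  induction es generalizing a with
  | nil =>
    constructor
    · rintro rfl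
      exact ⟨[a], ⟨rfl, by simp⟩, rfl, rfl⟩
    · rintro ⟨vs, ⟨hl, -⟩, ha, hb⟩
      obtain ⟨x, rfl⟩ := List.length_eq_one_iff.1 hl
      simp_all [Joins]
  | cons e es ih =>
    constructor
    · rintro ⟨c, hc, h⟩
      obtain ⟨vs, hw, hh, hb⟩ := ih.1 h
      obtain ⟨vs, rfl⟩ := List.head?_eq_some_iff.1 hh
      exact ⟨a :: c :: vs, isUMWalk_cons_cons.2 ⟨hc, hw⟩, rfl, by simpa using hb⟩
    · rintro ⟨vs, hw, ha, hb⟩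
      match vs, hw, ha, hb with
      | [], hw, ha, hb => simp at ha
      | [x], hw, ha, hb => simp [IsUMWalk] at hw
      | x :: c :: vs, hw, ha, hb =>
        obtain rfl : x = a := by simpa using ha
        obtain ⟨hc, hw⟩ := isUMWalk_cons_cons.1 hw
        exact ⟨c, hc, ih.2 ⟨c :: vs, hw, rfl, by simpa using hb⟩⟩

/-- `fs` arises from `es` by replacing every edge by its three sub-edges, in one of the two
directions. -/
inductive Expands {E : Type*} : List E → List (E × Fin 3) → Prop
  | nil : Expands [] []
  | forward (e : E) {es : List E} {fs : List (E × Fin 3)} (h : Expands es fs) :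
      Expands (e :: es) ((e, 0) :: (e, 1) :: (e, 2) :: fs)
  | backward (e : E) {es : List E} {fs : List (E × Fin 3)} (h : Expands es fs) :
      Expands (e :: es) ((e, 2) :: (e, 1) :: (e, 0) :: fs)

namespace Expands

variable {E : Type*} {es : List E} {fs : List (E × Fin 3)}

theorem mem_iff (h : Expands es fs) (q : E × Fin 3) : q ∈ fs ↔ q.1 ∈ es := by
  obtain ⟨e, k⟩ := q
  induction h with
  | nil => simp
  | forward e' _ ih | backward e' _ ih =>
    simp only [List.mem_cons, ih, Prod.mk.injEq]
    fin_cases k <;> simp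

theorem nodup_iff (h : Expands es fs) : fs.Nodup ↔ es.Nodup := by
  induction h with
  | nil => simp
  | forward e h ih | backward e h ih => simp [h.mem_iff, ih]

theorem getElem?_div (h : Expands es fs) {r : ℕ} {q : E × Fin 3} (hq : fs[r]? = some q) :
    es[r / 3]? = some q.1 := by
  induction h generalizing r with
  | nil => simp at hq
  | forward e _ ih | backward e _ ih =>
    match r, hq with
    | 0, hq | 1, hq | 2, hq => simp at hq; simp [← hq]
    | r + 3, hq => simpa using ih (r := r) (by simpa using hq)

theorem getElem?_middle (h : Expands es fs) {r : ℕ} {e : E} (he : es[r]? = some e) :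
    fs[3 * r + 1]? = some (e, 1) := by
  induction h generalizing r with
  | nil => simp at he
  | forward e' _ ih | backward e' _ ih =>
    cases r with
    | zero => simpa using he
    | succ r => simpa [Nat.mul_add] using ih (r := r) (by simpa using he)

end Expands

theorem exists_shared_iff {E : Type*} {p : ℕ} {A : Fin p → List E}
    {B : Fin p → List (E × Fin 3)} (h : ∀ i, Expands (A i) (B i)) :
    (∃ e, SharedMultiEdge A e) ↔ ∃ q, SharedMultiEdge B q := by
  constructor
  · rintro ⟨e, i, j, hij, r, hi, hj⟩
    exact ⟨_, i, j, hij, _, (h i).getElem?_middle hi, (h j).getElem?_middle hj⟩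
  · rintro ⟨q, i, j, hij, r, hi, hj⟩
    exact ⟨_, i, j, hij, _, (h i).getElem?_div hi, (h j).getElem?_div hj⟩

section Subdivision

variable {V E : Type*} {tl hd : E → V}

theorem Joins.exists_expands {a b : V} {es : List E} (h : Joins tl hd a es b) :
    ∃ fs, Expands es fs ∧ Joins (subTl tl) (subHd hd) (Sum.inl a) fs (Sum.inl b) := by
  induction es generalizing a with
  | nil => exact ⟨[], .nil, congrArg Sum.inl h⟩
  | cons e es ih =>
    obtain ⟨c, hc, h⟩ := h
    obtain ⟨fs, hx, hj⟩ := ih h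
    rcases Sym2.eq_iff.1 hc with ⟨rfl, rfl⟩ | ⟨rfl, rfl⟩
    · exact ⟨_, .forward e hx, Sum.inr (e, 0), by simp [subTl, subHd],
        Sum.inr (e, 1), by simp [subTl, subHd], Sum.inl (hd e), by simp [subTl, subHd], hj⟩
    · exact ⟨_, .backward e hx, Sum.inr (e, 1), by simp [subTl, subHd],
        Sum.inr (e, 0), by simp [subTl, subHd], Sum.inl (tl e), by simp [subTl, subHd], hj⟩

theorem eq_of_sub_eq_inl {f : E × Fin 3} {a : V} {c : V ⊕ E × Fin 2}
    (h : s(subTl tl f, subHd hd f) = s(Sum.inl a, c)) :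
    (f = (f.1, 0) ∧ tl f.1 = a ∧ c = Sum.inr (f.1, 0)) ∨
      (f = (f.1, 2) ∧ hd f.1 = a ∧ c = Sum.inr (f.1, 1)) := by
  obtain ⟨e, k⟩ := f
  fin_cases k <;> simp [subTl, subHd] at h ⊢ <;> grind

theorem eq_of_sub_eq_inr_zero {f : E × Fin 3} {e : E} {c : V ⊕ E × Fin 2}
    (h : s(subTl tl f, subHd hd f) = s(Sum.inr (e, 0), c)) :
    (f = (e, 0) ∧ c = Sum.inl (tl e)) ∨ (f = (e, 1) ∧ c = Sum.inr (e, 1)) := by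
  obtain ⟨e, k⟩ := f
  fin_cases k <;> simp [subTl, subHd] at h ⊢ <;> grind

theorem eq_of_sub_eq_inr_one {f : E × Fin 3} {e : E} {c : V ⊕ E × Fin 2}
    (h : s(subTl tl f, subHd hd f) = s(Sum.inr (e, 1), c)) :
    (f = (e, 1) ∧ c = Sum.inr (e, 0)) ∨ (f = (e, 2) ∧ c = Sum.inl (hd e)) := by
  obtain ⟨e, k⟩ := f
  fin_cases k <;> simp [subTl, subHd] at h ⊢ <;> grind

theorem exists_expands_of_joins_sub {a b : V} :
    ∀ {fs : List (E × Fin 3)}, fs.Nodup →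
      Joins (subTl tl) (subHd hd) (Sum.inl a) fs (Sum.inl b) →
      ∃ es, Expands es fs ∧ Joins tl hd a es b
  | [], _, h => ⟨[], .nil, Sum.inl_injective h⟩
  | [f], _, ⟨c, hc, h⟩ => by
    obtain rfl : c = Sum.inl b := h
    rcases eq_of_sub_eq_inl hc with h | h <;> simp at h
  | [f, g], hn, ⟨c, hc, d, hd', h⟩ => by
    obtain rfl : d = Sum.inl b := h
    rcases eq_of_sub_eq_inl hc with ⟨h1, -, rfl⟩ | ⟨h1, -, rfl⟩
    · rcases eq_of_sub_eq_inr_zero hd' with h2 | h2 <;> grind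
    · rcases eq_of_sub_eq_inr_one hd' with h2 | h2 <;> grind
  | f :: g :: k :: fs, hn, ⟨c, hc, d, hd', x, hx, h⟩ => by
    have hn' : fs.Nodup := by simp at hn; tauto
    obtain ⟨e, i⟩ := f
    rcases eq_of_sub_eq_inl hc with ⟨h1, rfl, rfl⟩ | ⟨h1, rfl, rfl⟩
    · obtain ⟨rfl, rfl⟩ := (eq_of_sub_eq_inr_zero hd').resolve_left (by grind)
      obtain ⟨rfl, rfl⟩ := (eq_of_sub_eq_inr_one hx).resolve_left (by grind)
      obtain ⟨es, hes, hj⟩ := exists_expands_of_joins_sub hn' h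
      exact ⟨e :: es, h1 ▸ .forward e hes, hd e, rfl, hj⟩
    · obtain ⟨rfl, rfl⟩ := (eq_of_sub_eq_inr_one hd').resolve_right (by grind)
      obtain ⟨rfl, rfl⟩ := (eq_of_sub_eq_inr_zero hx).resolve_right (by grind)
      obtain ⟨es, hes, hj⟩ := exists_expands_of_joins_sub hn' h
      exact ⟨e :: es, h1 ▸ .backward e hes, tl e, Sym2.eq_swap, hj⟩

end Subdivision

/-- A family of trails without shared edges is determined by the edge lists. -/
theorem exists_trails_iff {V E : Type*} {tl hd : E → V} {s t : V} {p : ℕ} :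
    (∃ W : Fin p → List V × List E,
      (∀ i : Fin p, IsUMWalk tl hd (W i).1 (W i).2 ∧ (W i).2.Nodup ∧
        (W i).1.head? = some s ∧ (W i).1.getLast? = some t) ∧
      ∀ e : E, ¬ SharedMultiEdge (fun i => (W i).2) e) ↔
    ∃ A : Fin p → List E, (∀ i, (A i).Nodup ∧ Joins tl hd s (A i) t) ∧
      ¬ ∃ e, SharedMultiEdge A e := by
  constructor
  · rintro ⟨W, hW, hs⟩
    refine ⟨fun i => (W i).2, fun i => ?_, not_exists.2 hs⟩
    obtain ⟨h1, h2, h3⟩ := hW i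
    exact ⟨h2, joins_iff_exists_isUMWalk.2 ⟨_, h1, h3⟩⟩
  · rintro ⟨A, hA, hs⟩
    choose vs hvs using fun i => joins_iff_exists_isUMWalk.1 (hA i).2
    exact ⟨fun i => (vs i, A i), fun i => ⟨(hvs i).1, (hA i).1, (hvs i).2⟩, not_exists.1 hs⟩

/-- Let `G` be an undirected multigraph (edge type `E`, endpoint
maps `tl, hd`) with distinct vertices `s, t`, and let `G'` be obtained from `G` by
replacing every edge by a path of length three. Then for every `p ≥ 1`, `G` admits
`p` `s`-`t` trails sharing no edge iff `G'` admits `p` `s`-`t` trails sharing no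
edge. -/
theorem stmt8 {V E : Type*} (tl hd : E → V) (s t : V) (hst : s ≠ t)
    (p : ℕ) (hp : 1 ≤ p) :
    (∃ W : Fin p → List V × List E,
      (∀ i : Fin p, IsUMWalk tl hd (W i).1 (W i).2 ∧ (W i).2.Nodup ∧
        (W i).1.head? = some s ∧ (W i).1.getLast? = some t) ∧
      ∀ e : E, ¬ SharedMultiEdge (fun i => (W i).2) e) ↔
    (∃ W : Fin p → List (V ⊕ E × Fin 2) × List (E × Fin 3),
      (∀ i : Fin p, IsUMWalk (subTl tl) (subHd hd) (W i).1 (W i).2 ∧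
        (W i).2.Nodup ∧
        (W i).1.head? = some (Sum.inl s) ∧ (W i).1.getLast? = some (Sum.inl t)) ∧
      ∀ e : E × Fin 3, ¬ SharedMultiEdge (fun i => (W i).2) e) := by
  rw [exists_trails_iff, exists_trails_iff]
  constructor
  · rintro ⟨A, hA, hs⟩
    choose B hAB hB using fun i => (hA i).2.exists_expands
    exact ⟨B, fun i => ⟨(hAB i).nodup_iff.2 (hA i).1, hB i⟩, mt (exists_shared_iff hAB).2 hs⟩
  · rintro ⟨B, hB, hs⟩
    choose A hAB hA using fun i => exists_expands_of_joins_sub (hB i).1 (hB i).2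
    exact ⟨A, fun i => ⟨(hAB i).nodup_iff.1 (hB i).1, hA i⟩, mt (exists_shared_iff hAB).1 hs⟩

end PaperRCA
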